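/- Uniform gradient bound after the first unsuccessful iteration in the noisy case (Lemma B.8). Under the noisy direct-search dynamics driven by the positive spanning set D, if k ∈ ℕ is such that some iteration j ≤ k is unsuccessful (j ∉ S), then ‖∇f(x_k)‖ ≤ η₂ α_k, where η₂ := (β/(2aκθ))(β + 3c). -/

import Mathlib

open RealInnerProductSpace Finset

section SmoothFunctions

variable {E : Type*} [NormedAddCommGroup E] [InnerProductSpace ℝ E] [CompleteSpace E]

/-- The descent lemma for a function with `β`-Lipschitz gradient. -/
theorem le_add_inner_gradient_add_sq {f : E → ℝ} {β : ℝ} (hf : Differentiable ℝ f)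
    (hsmooth : ∀ x y : E, ‖gradient f x - gradient f y‖ ≤ β * ‖x - y‖) (x w : E) :
    f (x + w) ≤ f x + ⟪gradient f x, w⟫ + β / 2 * ‖w‖ ^ 2 := by
  have hder : ∀ t : ℝ, HasDerivAt
      (fun t : ℝ => f (x + t • w) - t * ⟪gradient f x, w⟫ - β / 2 * ‖w‖ ^ 2 * t ^ 2)
      (⟪gradient f (x + t • w), w⟫ - ⟪gradient f x, w⟫ - β * ‖w‖ ^ 2 * t) t := by
    intro t
    have hline : HasDerivAt (fun t : ℝ => x + t • w) w t := by
      simpa using ((hasDerivAt_id t).smul_const w).const_add x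
    have hcomp := (hf (x + t • w)).hasGradientAt.hasFDerivAt.comp_hasDerivAt t hline
    simp only [InnerProductSpace.toDual_apply_apply] at hcomp
    have hlin := (hasDerivAt_id t).mul_const ⟪gradient f x, w⟫
    have hsq := (hasDerivAt_pow 2 t).const_mul (β / 2 * ‖w‖ ^ 2)
    refine ((hcomp.sub hlin).sub hsq).congr_deriv ?_
    simp
    ring
  have hanti := antitoneOn_of_deriv_nonpos (convex_Icc (0 : ℝ) 1)
    (fun t _ => (hder t).continuousAt.continuousWithinAt)
    (fun t _ => (hder t).differentiableAt.differentiableWithinAt)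
    (fun t ht => by
      rw [interior_Icc] at ht
      rw [(hder t).deriv, ← inner_sub_left]
      have hinner := real_inner_le_norm (gradient f (x + t • w) - gradient f x) w
      have hlip := hsmooth (x + t • w) x
      rw [add_sub_cancel_left, norm_smul, Real.norm_of_nonneg ht.1.le] at hlip
      nlinarith [mul_le_mul_of_nonneg_right hlip (norm_nonneg w)])
  have h := hanti (Set.left_mem_Icc.2 zero_le_one) (Set.right_mem_Icc.2 zero_le_one) zero_le_one
  simp only [one_smul, zero_smul, add_zero] at h
  linarith

/-- If the step `r` along every direction of a set with cosine measure at least `κ` decreases `f`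
by at most `C * r ^ 2`, then the gradient is of order `r`. -/
theorem norm_gradient_le_of_forall_decrease_le {f : E → ℝ} {β κ C r : ℝ} {D : Finset E} {x : E}
    (hf : Differentiable ℝ f)
    (hsmooth : ∀ x y : E, ‖gradient f x - gradient f y‖ ≤ β * ‖x - y‖)
    (hβ : 0 ≤ β) (hC : 0 ≤ C) (hr : 0 < r) (hunit : ∀ v ∈ D, ‖v‖ = 1)
    (hcm : ∀ u : E, u ≠ 0 → ∃ v ∈ D, ⟪u, v⟫ ≥ κ * ‖u‖)
    (hdec : ∀ v ∈ D, f x - f (x + r • v) ≤ C * r ^ 2) :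
    κ * ‖gradient f x‖ ≤ (β / 2 + C) * r := by
  by_cases hg : gradient f x = 0
  · rw [hg, norm_zero, mul_zero]
    positivity
  · obtain ⟨v, hv, hcos⟩ := hcm (-gradient f x) (neg_ne_zero.2 hg)
    rw [inner_neg_left, norm_neg] at hcos
    have hdescent := le_add_inner_gradient_add_sq hf hsmooth x (r • v)
    rw [real_inner_smul_right, norm_smul, hunit v hv, Real.norm_of_nonneg hr.le, mul_one]
      at hdescent
    have hmul := mul_le_mul_of_nonneg_left hcos hr.le
    refine le_of_mul_le_mul_left ?_ hr
    linarith [hdec v hv]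

/-- For a strongly convex function with Lipschitz gradient, the gradient on the sublevel set of `y`
is controlled by the gradient at `y`. -/
theorem norm_gradient_le_of_le {f : E → ℝ} {a β : ℝ} {xstar x y : E} (ha : 0 < a) (hβ : 0 ≤ β)
    (hsmooth : ∀ x y : E, ‖gradient f x - gradient f y‖ ≤ β * ‖x - y‖)
    (hconv : ∀ x y : E, f y ≥ f x + ⟪gradient f x, y - x⟫ + a * ‖y - x‖ ^ 2)
    (hmin : ∀ y, f xstar ≤ f y) (hxy : f x ≤ f y) :
    ‖gradient f x‖ ≤ β / (2 * a) * ‖gradient f y‖ := by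
  have hcrit : gradient f xstar = 0 := by
    have hloc : IsLocalMin f xstar := Filter.Eventually.of_forall hmin
    rw [gradient, hloc.fderiv_eq_zero, map_zero]
  have hlip := hsmooth x xstar
  have hlower := hconv xstar x
  have hupper := hconv y xstar
  rw [hcrit, sub_zero] at hlip
  rw [hcrit, inner_zero_left] at hlower
  have hinner := neg_le_of_abs_le (abs_real_inner_le_norm (gradient f y) (xstar - y))
  have hsq : (2 * a * ‖x - xstar‖) ^ 2 ≤ ‖gradient f y‖ ^ 2 := by
    have h : a * ‖x - xstar‖ ^ 2
        ≤ ‖gradient f y‖ * ‖xstar - y‖ - a * ‖xstar - y‖ ^ 2 := by linarith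
    nlinarith [mul_le_mul_of_nonneg_left h ha.le,
      sq_nonneg (‖gradient f y‖ - 2 * a * ‖xstar - y‖)]
  have hdist := (abs_le_of_sq_le_sq' hsq (norm_nonneg _)).2
  calc ‖gradient f x‖ ≤ β * ‖x - xstar‖ := hlip
    _ = β / (2 * a) * (2 * a * ‖x - xstar‖) := by field_simp
    _ ≤ β / (2 * a) * ‖gradient f y‖ := by gcongr

end SmoothFunctions

theorem stmt13 {d : ℕ} (hd : 1 ≤ d)
    (f : EuclideanSpace ℝ (Fin d) → ℝ) (a β : ℝ) (ha : 0 < a) (hβ : 0 < β)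
    (hdiff : ContDiff ℝ 1 f)
    (hsmooth : ∀ x y : EuclideanSpace ℝ (Fin d), ‖gradient f x - gradient f y‖ ≤ β * ‖x - y‖)
    (hconv : ∀ x y : EuclideanSpace ℝ (Fin d),
      f y ≥ f x + ⟪gradient f x, y - x⟫ + a * ‖y - x‖ ^ 2)
    (xstar : EuclideanSpace ℝ (Fin d)) (hmin : ∀ y, f xstar ≤ f y)
    (D : Finset (EuclideanSpace ℝ (Fin d))) (hDne : D.Nonempty)
    (hunit : ∀ v ∈ D, ‖v‖ = 1) (κ : ℝ) (hκ : 0 < κ)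
    (hcm : ∀ u : EuclideanSpace ℝ (Fin d), u ≠ 0 → ∃ v ∈ D, ⟪u, v⟫ ≥ κ * ‖u‖)
    (α₀ θ c : ℝ) (hα₀ : 0 < α₀) (hθ : θ ∈ Set.Ioo (0 : ℝ) 1) (hc : 0 < c)
    (x : ℕ → EuclideanSpace ℝ (Fin d)) (α : ℕ → ℝ) (S : Set ℕ) (hα0 : α 0 = α₀)
    (hsucc : ∀ k ∈ S, ∃ v ∈ D, f (x k) - f (x k + α k • v) ≥ (c / 2) * α k ^ 2 ∧
      x (k + 1) = x k + α k • v ∧ α (k + 1) = α k)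
    (hfail : ∀ k ∉ S, (∀ v ∈ D, f (x k) - f (x k + α k • v) ≤ (3 * c / 2) * α k ^ 2) ∧
      x (k + 1) = x k ∧ α (k + 1) = θ * α k)
    (k : ℕ) (hunsucc : ∃ j ≤ k, j ∉ S) :
    ‖gradient f (x k)‖ ≤ ((β / (2 * a * κ * θ)) * (β + 3 * c)) * α k := by
  have hαpos : ∀ n, 0 < α n := by
    intro n
    induction n with
    | zero => rwa [hα0]
    | succ n ih =>
      by_cases hn : n ∈ S
      · obtain ⟨v, -, -, -, hαn⟩ := hsucc n hn
        rwa [hαn]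
      · rw [(hfail n hn).2.2]
        exact mul_pos hθ.1 ih
  have hlast : ∃ j ∉ S, f (x k) ≤ f (x j) ∧ θ * α j ≤ α k := by
    have hself : ∀ n, θ * α n ≤ α n := fun n =>
      mul_le_of_le_one_left (hαpos n).le hθ.2.le
    induction k with
    | zero =>
      obtain ⟨j, hj, hjS⟩ := hunsucc
      obtain rfl := Nat.le_zero.1 hj
      exact ⟨0, hjS, le_rfl, hself 0⟩
    | succ n ih =>
      by_cases hn1 : n + 1 ∈ S
      · by_cases hn : n ∈ S
        · obtain ⟨i, hi, hiS⟩ := hunsucc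
          have hin : i ≤ n := Nat.le_of_lt_succ (hi.lt_of_ne fun h => hiS (h ▸ hn1))
          obtain ⟨j, hjS, hfj, hαj⟩ := ih ⟨i, hin, hiS⟩
          obtain ⟨v, -, hdec, hxn, hαn⟩ := hsucc n hn
          refine ⟨j, hjS, ?_, hαn ▸ hαj⟩
          rw [hxn]
          have : 0 ≤ c / 2 * α n ^ 2 := by positivity
          linarith
        · obtain ⟨-, hxn, hαn⟩ := hfail n hn
          exact ⟨n, hn, by rw [hxn], hαn.ge⟩
      · exact ⟨n + 1, hn1, le_rfl, hself (n + 1)⟩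
  obtain ⟨j, hjS, hfj, hαj⟩ := hlast
  have hθ0 := hθ.1
  have hgj := norm_gradient_le_of_forall_decrease_le (hdiff.differentiable one_ne_zero) hsmooth
    hβ.le (by positivity) (hαpos j) hunit hcm (hfail j hjS).1
  have hgj' : ‖gradient f (x j)‖ ≤ (β + 3 * c) / (κ * θ) * α k := by
    have hmul := mul_le_mul_of_nonneg_left hgj hθ0.le
    have hstep := mul_le_mul_of_nonneg_left hαj (by positivity : 0 ≤ β / 2 + 3 * c / 2)
    have hnonneg : 0 ≤ (β / 2 + 3 * c / 2) * α k := mul_nonneg (by positivity) (hαpos k).le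
    rw [div_mul_eq_mul_div, le_div_iff₀ (by positivity)]
    linarith
  calc ‖gradient f (x k)‖ ≤ β / (2 * a) * ‖gradient f (x j)‖ :=
        norm_gradient_le_of_le ha hβ.le hsmooth hconv hmin hfj
    _ ≤ β / (2 * a) * ((β + 3 * c) / (κ * θ) * α k) := by gcongr
    _ = ((β / (2 * a * κ * θ)) * (β + 3 * c)) * α k := by field_simp
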